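/- There exists a set of 34 points in the plane in general position that contains no 8-crossing family. -/

import Mathlib

/-- A finite set of points in the plane is in *general position* if no three of
its points are collinear. -/
def GenPos (S : Finset (ℝ × ℝ)) : Prop :=
  ∀ p ∈ S, ∀ q ∈ S, ∀ r ∈ S, p ≠ q → p ≠ r → q ≠ r →
    ¬Collinear ℝ ({p, q, r} : Set (ℝ × ℝ))

/-- Two closed segments `pq` and `rs` *cross* if they intersect in exactly one
point, which lies in the interior of both segments. -/
def Crosses (p q r s : ℝ × ℝ) : Prop :=
  ∃ x : ℝ × ℝ, x ∈ openSegment ℝ p q ∧ x ∈ openSegment ℝ r s ∧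
    segment ℝ p q ∩ segment ℝ r s = {x}

/-- `F` is a *crossing family* in `S`: a finite set of segments (given by their
pairs of distinct endpoints, which belong to `S`) that pairwise cross. -/
def IsCrossingFamily (S : Finset (ℝ × ℝ)) (F : Finset ((ℝ × ℝ) × (ℝ × ℝ))) : Prop :=
  (∀ e ∈ F, e.1 ∈ S ∧ e.2 ∈ S ∧ e.1 ≠ e.2) ∧
  (∀ e ∈ F, ∀ f ∈ F, e ≠ f → Crosses e.1 e.2 f.1 f.2)

/-- `S` contains a `k`-crossing family. -/
def HasCrossingFamily (S : Finset (ℝ × ℝ)) (k : ℕ) : Prop :=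
  ∃ F : Finset ((ℝ × ℝ) × (ℝ × ℝ)), IsCrossingFamily S F ∧ F.card = k

/-- `cf S`: the maximum size of a crossing family in `S`. -/
noncomputable def cf (S : Finset (ℝ × ℝ)) : ℕ :=
  sSup {k : ℕ | HasCrossingFamily S k}

/-- `cfNat n`: the minimum of `cf S` over all sets `S` of `n` points in
general position. -/
noncomputable def cfNat (n : ℕ) : ℕ :=
  sInf {m : ℕ | ∃ S : Finset (ℝ × ℝ), S.card = n ∧ GenPos S ∧ cf S = m}

/-! ### Bit masks -/

/-- The natural number whose `i`-th bit is `f i` for `i < n`, all other bits being zero. -/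
def maskOf (f : ℕ → Bool) : ℕ → ℕ
  | 0 => 0
  | n + 1 => bif f n then maskOf f n ||| 1 <<< n else maskOf f n

theorem testBit_maskOf (f : ℕ → Bool) (n i : ℕ) :
    (maskOf f n).testBit i = (decide (i < n) && f i) := by
  induction n with
  | zero => simp [maskOf]
  | succ n ih =>
    have h1 : (maskOf f n ||| 1 <<< n).testBit i
        = ((maskOf f n).testBit i || decide (n = i)) := by
      rw [Nat.testBit_or, Nat.one_shiftLeft, Nat.testBit_two_pow]
    by_cases hn : n = i
    · subst hn
      cases h : f n <;> simp [maskOf, h, h1, ih]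
    · have : (i < n + 1) ↔ i < n := by omega
      cases h : f n <;> simp [maskOf, h, h1, ih, hn, this]

theorem maskOf_lt (f : ℕ → Bool) (n : ℕ) : maskOf f n < 2 ^ n := by
  apply Nat.lt_pow_two_of_testBit
  intro i hi
  simp [testBit_maskOf, hi]

/-- The concatenation of the blocks `f 0, …, f (n - 1)`, each of width `w`. -/
def blocks (w : ℕ) (f : ℕ → ℕ) : ℕ → ℕ
  | 0 => 0
  | n + 1 => blocks w f n ||| f n <<< (w * n)

theorem blocks_lt {w : ℕ} {f : ℕ → ℕ} {n : ℕ} (hf : ∀ i < n, f i < 2 ^ w) :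
    blocks w f n < 2 ^ (w * n) := by
  induction n with
  | zero => simp [blocks]
  | succ n ih =>
    apply Nat.or_lt_two_pow
    · exact (ih fun i hi => hf i (by omega)).trans_le
        (Nat.pow_le_pow_right (by norm_num) (by nlinarith))
    · rw [Nat.shiftLeft_eq, mul_add, pow_add, mul_one, mul_comm]
      exact Nat.mul_lt_mul_of_pos_left (hf n (by omega)) (by positivity)

theorem testBit_blocks {w : ℕ} {f : ℕ → ℕ} {n c d : ℕ} (hf : ∀ i < n, f i < 2 ^ w)
    (hc : c < n) (hd : d < w) : (blocks w f n).testBit (w * c + d) = (f c).testBit d := by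
  induction n with
  | zero => simp at hc
  | succ n ih =>
    have hf' : ∀ i < n, f i < 2 ^ w := fun i hi => hf i (by omega)
    rw [blocks, Nat.testBit_or, Nat.testBit_shiftLeft]
    rcases Nat.lt_succ_iff_lt_or_eq.1 hc with h | h
    · have : w * c + d < w * n := by nlinarith
      simp [ih hf' h, Nat.not_le.2 this]
    · subst h
      have : (blocks w f c).testBit (w * c + d) = false :=
        Nat.testBit_lt_two_pow ((blocks_lt hf').trans_le
          (Nat.pow_le_pow_right (by norm_num) (by omega)))
      simp [this]

/-- The `i`-th block of width `w` of `t`. -/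
def block (w t i : ℕ) : ℕ := (t >>> (w * i)) % 2 ^ w

theorem block_lt (w t i : ℕ) : block w t i < 2 ^ w := Nat.mod_lt _ (by positivity)

theorem testBit_block {w t i j : ℕ} (hj : j < w) :
    (block w t i).testBit j = t.testBit (w * i + j) := by
  simp [block, Nat.testBit_mod_two_pow, Nat.testBit_shiftRight, hj]

/-- `f n`, written so that the kernel evaluates `n` to a literal first. -/
def force {α : Type} (n : ℕ) (f : ℕ → α) : α := Nat.rec (f 0) (fun m _ => f m) (n + 1)

theorem force_eq {α : Type} (n : ℕ) (f : ℕ → α) : force n f = f n := rfl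

/-! ### A clique search

Vertices are natural numbers `64 ≤ v`, and bit `j` of `A i` says whether `i` and `j` are adjacent.
The lower 64 bits of a number representing a set of vertices carry no information. They are filled
in such a way that different numbers tend to differ there, because the kernel hashes literals by
their lower 64 bits. The function `pick` should select a vertex of a nonempty set, but correctness
does not depend on this. -/

/-- The elements of `K` whose bit in `U` is set. -/
def bitsIn (K : Finset ℕ) (U : ℕ) : Finset ℕ := K.filter fun i => U.testBit i = true

/-- Two elements of `K` are adjacent in the graph with rows `A` exactly when they are distinct. -/
def IsBitClique (A : ℕ → ℕ) (K : Finset ℕ) : Prop :=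
  ∀ i ∈ K, ∀ j ∈ K, (A i).testBit j = decide (i ≠ j)

/-- The set `{v}`, with some lower bits. -/
def mark (v : ℕ) : ℕ := 1 <<< v ||| v * 2345678901234566 % 2 ^ 64

/-- Removes from `U` an independent set of the graph `A`, chosen greedily from `Q`. -/
def strip (A pick : ℕ → ℕ) : ℕ → ℕ → ℕ → ℕ
  | 0, _, U => U
  | k + 1, Q, U =>
    force (pick Q) fun v =>
      bif Q.testBit v then
        force (Q ^^^ (Q &&& A v) ^^^ mark v) fun Q₁ =>
        force (U ^^^ mark v) fun U₁ => strip A pick k Q₁ U₁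
      else U

/-- Applies `strip` to `U` the given number of times. -/
def strips (A pick : ℕ → ℕ) (fuel : ℕ) : ℕ → ℕ → ℕ
  | 0, U => U
  | k + 1, U => force (strip A pick fuel U U) fun U₁ => strips A pick fuel k U₁

/-- Checks with `s` the neighbourhood in `C` of each vertex of `U` in turn, deleting from `C` the
vertices already treated. -/
def branch (A pick : ℕ → ℕ) (s : ℕ → Bool) : ℕ → ℕ → ℕ → Bool
  | 0, _, _ => false
  | k + 1, U, C =>
    bif Nat.blt U (2 ^ 64) then true else
      force (pick U) fun v =>
      force (C ^^^ mark v) fun C₁ =>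
      bif force (C &&& (A v ||| (2 ^ 64 - 1))) s then
        force (U ^^^ mark v) fun U₁ => branch A pick s k U₁ C₁
      else false

/-- A search which can only succeed if the graph `A` has no clique of more than `n` vertices
inside `C`. -/
def search (A pick : ℕ → ℕ) (fuel : ℕ) : ℕ → ℕ → Bool
  | 0, C => Nat.blt C (2 ^ 64)
  | n + 1, C => force (strips A pick fuel (n + 1) C) fun U =>
      branch A pick (search A pick fuel n) fuel U C

theorem mem_bitsIn {K : Finset ℕ} {U i : ℕ} : i ∈ bitsIn K U ↔ i ∈ K ∧ U.testBit i = true := by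
  simp [bitsIn]

theorem bitsIn_eq_empty_of_lt {K : Finset ℕ} (hK : ∀ i ∈ K, 64 ≤ i) {U : ℕ} (hU : U < 2 ^ 64) :
    bitsIn K U = ∅ := by
  refine Finset.filter_eq_empty_iff.2 fun i hi => ?_
  rw [Nat.testBit_lt_two_pow (hU.trans_le (Nat.pow_le_pow_right (by norm_num) (hK i hi)))]
  simp

theorem testBit_xor_mark (U v : ℕ) {i : ℕ} (hi : 64 ≤ i) :
    (U ^^^ mark v).testBit i = (U.testBit i ^^ decide (v = i)) := by
  have : (v * 2345678901234566 % 2 ^ 64).testBit i = false := by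
    rw [Nat.testBit_mod_two_pow]
    simp [Nat.not_lt.2 hi]
  rw [Nat.testBit_xor, mark, Nat.testBit_or, this, Nat.one_shiftLeft, Nat.testBit_two_pow,
    Bool.or_false]

theorem bitsIn_xor_mark_of_notMem {K : Finset ℕ} (hK : ∀ i ∈ K, 64 ≤ i) {v : ℕ} (U : ℕ)
    (hv : v ∉ K) : bitsIn K (U ^^^ mark v) = bitsIn K U := by
  ext i
  rw [mem_bitsIn, mem_bitsIn]
  refine and_congr_right fun hi => ?_
  have : v ≠ i := fun h => hv (h ▸ hi)
  simp [testBit_xor_mark U v (hK i hi), this]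

theorem card_bitsIn_le_xor_mark {K : Finset ℕ} (hK : ∀ i ∈ K, 64 ≤ i) (U v : ℕ) :
    (bitsIn K U).card ≤ (bitsIn K (U ^^^ mark v)).card + 1 := by
  have : bitsIn K U ⊆ insert v (bitsIn K (U ^^^ mark v)) := by
    intro i hi
    rw [mem_bitsIn] at hi
    rw [Finset.mem_insert, mem_bitsIn, testBit_xor_mark U v (hK i hi.1)]
    by_cases h : v = i
    · exact Or.inl h.symm
    · exact Or.inr ⟨hi.1, by simp [h, hi.2]⟩
  exact (Finset.card_le_card this).trans (Finset.card_insert_le _ _)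

theorem card_bitsIn_le_strip {A : ℕ → ℕ} {K : Finset ℕ} (hK : ∀ i ∈ K, 64 ≤ i)
    (hA : IsBitClique A K) (pick : ℕ → ℕ) (k Q U : ℕ) : (bitsIn K U).card ≤
      (bitsIn K (strip A pick k Q U)).card + if bitsIn K Q = ∅ then 0 else 1 := by
  induction k generalizing Q U with
  | zero => simp [strip]
  | succ k ih =>
    rw [strip, force_eq]
    set v := pick Q
    cases hQ : Q.testBit v
    · simp
    · rw [cond_true, force_eq, force_eq]
      set Q₁ := Q ^^^ (Q &&& A v) ^^^ mark v with hQ₁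
      have hbit (i : ℕ) (hi : 64 ≤ i) : Q₁.testBit i =
          ((Q.testBit i && !(A v).testBit i) ^^ decide (v = i)) := by
        rw [hQ₁, testBit_xor_mark _ _ hi, Nat.testBit_xor, Nat.testBit_and]
        cases Q.testBit i <;> cases (A v).testBit i <;> rfl
      have h := ih Q₁ (U ^^^ mark v)
      by_cases hvK : v ∈ K
      · have hle := card_bitsIn_le_xor_mark hK U v
        rw [if_neg (Finset.ne_empty_of_mem (mem_bitsIn.2 ⟨hvK, hQ⟩))]
        have hempty : bitsIn K Q₁ = ∅ := by
          refine Finset.filter_eq_empty_iff.2 fun i hi => ?_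
          rw [hbit i (hK i hi), hA v hvK i hi]
          by_cases hiv : v = i
          · simp [← hiv, hQ]
          · simp [hiv]
        rw [if_pos hempty] at h
        omega
      · rw [bitsIn_xor_mark_of_notMem hK U hvK] at h
        have hsub : bitsIn K Q₁ ⊆ bitsIn K Q := by
          intro i hi
          rw [mem_bitsIn] at hi
          have hiv : v ≠ i := fun h => hvK (h ▸ hi.1)
          rw [hbit i (hK i hi.1)] at hi
          simp_all [mem_bitsIn]
        refine h.trans (Nat.add_le_add_left ?_ _)
        by_cases hne : bitsIn K Q = ∅
        · rw [if_pos (Finset.subset_empty.1 (hne ▸ hsub))]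
          exact Nat.zero_le _
        · rw [if_neg hne]
          split_ifs <;> simp

theorem card_bitsIn_le_strips {A : ℕ → ℕ} {K : Finset ℕ} (hK : ∀ i ∈ K, 64 ≤ i)
    (hA : IsBitClique A K) (pick : ℕ → ℕ) (fuel k U : ℕ) :
    (bitsIn K U).card ≤ (bitsIn K (strips A pick fuel k U)).card + k := by
  induction k generalizing U with
  | zero => simp [strips]
  | succ k ih =>
    rw [strips, force_eq]
    have h1 := card_bitsIn_le_strip hK hA pick fuel U U
    have h2 := ih (strip A pick fuel U U)
    split_ifs at h1 <;> omega

theorem bitsIn_eq_empty_of_branch {A pick : ℕ → ℕ} {s : ℕ → Bool} {n : ℕ} (hs : ∀ C, s C = true →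
      ∀ K, (∀ i ∈ K, 64 ≤ i) → IsBitClique A K → bitsIn K C = K → K.card ≤ n)
    {K : Finset ℕ} (hK : ∀ i ∈ K, 64 ≤ i) (hA : IsBitClique A K) (hcard : n + 1 < K.card)
    {k U C : ℕ} (hb : branch A pick s k U C = true) (hC : bitsIn K C = K) :
    bitsIn K U = ∅ := by
  induction k generalizing U C with
  | zero => simp [branch] at hb
  | succ k ih =>
    rw [branch] at hb
    cases hU : Nat.blt U (2 ^ 64)
    · rw [hU, cond_false, force_eq, force_eq, force_eq, force_eq] at hb
      set v := pick U
      rw [Bool.cond_false_right, Bool.and_eq_true] at hb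
      have hvK : v ∉ K := by
        intro hv
        have hsub := hs _ hb.1 (K.erase v) (fun i hi => hK i (Finset.mem_of_mem_erase hi))
          (fun i hi j hj => hA i (Finset.mem_of_mem_erase hi) j (Finset.mem_of_mem_erase hj)) ?_
        · rw [Finset.card_erase_of_mem hv] at hsub
          omega
        · refine Finset.filter_true_of_mem fun i hi => ?_
          have hiK := Finset.mem_of_mem_erase hi
          have hiC : C.testBit i = true := (mem_bitsIn.1 (hC.symm ▸ hiK)).2
          rw [Nat.testBit_and, Nat.testBit_or, hiC,
            hA v hv i hiK, decide_eq_true (Finset.ne_of_mem_erase hi).symm]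
          rfl
      have := ih hb.2 ((bitsIn_xor_mark_of_notMem hK C hvK).trans hC)
      rwa [bitsIn_xor_mark_of_notMem hK U hvK] at this
    · exact bitsIn_eq_empty_of_lt hK (Nat.blt_eq ▸ hU)

theorem card_le_of_search {A pick : ℕ → ℕ} {fuel n : ℕ} : ∀ C, search A pick fuel n C = true →
    ∀ K, (∀ i ∈ K, 64 ≤ i) → IsBitClique A K → bitsIn K C = K → K.card ≤ n := by
  induction n with
  | zero =>
    intro C hC K hK _ hKC
    rw [search] at hC
    rw [← hKC, bitsIn_eq_empty_of_lt hK (Nat.blt_eq ▸ hC), Finset.card_empty]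
  | succ n ih =>
    intro C hC K hK hA hKC
    rw [search, force_eq] at hC
    by_contra hlt
    have h1 := bitsIn_eq_empty_of_branch ih hK hA (not_le.1 hlt) hC hKC
    have h2 := card_bitsIn_le_strips hK hA pick fuel (n + 1) C
    rw [h1, hKC, Finset.card_empty] at h2
    omega

/-- For distinct residues `2 ^ (64 + v) % 1171` with `v < n`, a lookup table for `64 + v`, with
entries of eleven bits. -/
def logTable : ℕ → ℕ
  | 0 => 0
  | v + 1 => logTable v ||| (64 + v) <<< (11 * (2 ^ (64 + v) % 1171))

/-- Looks up the position of the lowest vertex of `U` in `l = logTable n`. -/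
def lowestVertex (l U : ℕ) : ℕ := block 11 l ((U ^^^ (U &&& (U - 2 ^ 64))) % 1171)

/-- The neighbours of `v` in the graph on the vertices from `64` to `63 + w` with adjacency matrix
`g`. -/
def rowOf (w g v : ℕ) : ℕ := block w g (v - 64) <<< 64

theorem testBit_rowOf {w : ℕ} (g i : ℕ) {j : ℕ} (hj : j < w) :
    (rowOf w g (64 + i)).testBit (64 + j) = g.testBit (w * i + j) := by
  unfold rowOf
  simp only [Nat.testBit_shiftLeft, Nat.add_sub_cancel_left, testBit_block hj, Nat.le_add_right,
    decide_true, Bool.true_and, ge_iff_le]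

/-! ### The point set -/

/-- Coordinates of 34 points: an approximation, up to an affine map, of a set consisting of a point
and eleven orbits of a rotation by `2π/3`. -/
def coords : List (ℕ × ℕ) :=
  [(513, 1109), (1190, 1518), (1997, 1987), (976, 1600), (2274, 2098), (185, 2299), (795, 1674),
    (518, 1211), (2299, 2114), (231, 537), (1088, 1421), (878, 1781), (394, 2106), (492, 2068),
    (9, 25), (1762, 1807), (625, 1235), (809, 1323), (207, 2287), (781, 1786), (201, 2290),
    (175, 302), (493, 2065), (234, 543), (699, 1490), (844, 1289), (193, 402), (1064, 1504),
    (1897, 1905), (12, 34), (0, 0), (1756, 1806), (312, 2124), (2265, 2092)]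

/-- The `i`-th point with its natural number coordinates. -/
def natPt (i : ℕ) : ℕ × ℕ := coords.getD i (0, 0)

/-- Whether `p`, `q`, `r` are in strict counterclockwise position. -/
def ccw (p q r : ℕ × ℕ) : Bool :=
  Nat.blt (p.2 * q.1 + q.2 * r.1 + r.2 * p.1) (p.1 * q.2 + q.1 * r.2 + r.1 * p.2)

/-- Bit `1156 * a + 34 * b + c` says whether the points `a`, `b`, `c` are in counterclockwise
position. -/
def ccwTable : ℕ :=
  blocks (34 * 34) (fun a => blocks 34 (fun b =>
    maskOf (fun c => ccw (natPt a) (natPt b) (natPt c)) 34) 34) 34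

/-- Given `t = ccwTable`, bit `34 * c + d` says whether the segments `ab` and `cd` cross. -/
def crossRow (t a b : ℕ) : ℕ :=
  force (block 34 t (34 * a + b)) fun l =>
  force (block 34 t (34 * b + a)) fun r =>
  blocks 34 (fun c => bif l.testBit c then r else bif r.testBit c then l else 0) 34 &&&
    (block (34 * 34) t a ^^^ block (34 * 34) t b)

/-- The concatenation of all rows `crossRow t a b`, where `t = ccwTable`. -/
def crossTable (t : ℕ) : ℕ :=
  blocks (34 * 34) (fun v => crossRow t (v / 34) (v % 34)) (34 * 34)

/-- Bit `34 * c + d` says whether `d < c`. -/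
def allSegments : ℕ := blocks 34 (fun c => maskOf (fun d => Nat.blt d c) 34) 34

theorem search_crossTable : (force ccwTable fun t => force (crossTable t) fun g =>
    force (logTable (34 * 34)) fun l => force (allSegments <<< 64) fun s =>
    search (rowOf (34 * 34) g) (lowestVertex l) (34 * 34) 7 s) = true := by
  decide +kernel

theorem natPt_det_ne : ∀ a < 34, ∀ b < a, ∀ c < b,
    (ccw (natPt a) (natPt b) (natPt c) || ccw (natPt b) (natPt a) (natPt c)) = true := by
  decide +kernel

theorem mul_add_lt_mul {m n a b : ℕ} (ha : a < n) (hb : b < m) : m * a + b < m * n := by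
  nlinarith

theorem testBit_ccwTable {a b c : ℕ} (ha : a < 34) (hb : b < 34) (hc : c < 34) :
    ccwTable.testBit (34 * 34 * a + (34 * b + c)) = ccw (natPt a) (natPt b) (natPt c) := by
  rw [ccwTable, testBit_blocks (fun i _ => blocks_lt fun j _ => maskOf_lt _ _) ha
    (mul_add_lt_mul hb hc), testBit_blocks (fun j _ => maskOf_lt _ _) hb hc, testBit_maskOf]
  simp [hc]

theorem testBit_block_ccwTable {a b c : ℕ} (ha : a < 34) (hb : b < 34) (hc : c < 34) :
    (block 34 ccwTable (34 * a + b)).testBit c = ccw (natPt a) (natPt b) (natPt c) := by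
  rw [testBit_block hc, ← testBit_ccwTable ha hb hc]
  congr 1
  ring

theorem crossRow_lt (t a b : ℕ) : crossRow t a b < 2 ^ (34 * 34) := by
  rw [crossRow, force_eq, force_eq]
  exact Nat.and_lt_two_pow (n := 34 * 34) _
    (Nat.xor_lt_two_pow (block_lt _ _ _) (block_lt _ _ _))

theorem testBit_crossRow {a b c d : ℕ} (ha : a < 34) (hb : b < 34) (hc : c < 34) (hd : d < 34) :
    (crossRow ccwTable a b).testBit (34 * c + d) =
      ((bif ccw (natPt a) (natPt b) (natPt c) then ccw (natPt b) (natPt a) (natPt d)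
        else ccw (natPt b) (natPt a) (natPt c) && ccw (natPt a) (natPt b) (natPt d)) &&
      (ccw (natPt a) (natPt c) (natPt d) ^^ ccw (natPt b) (natPt c) (natPt d))) := by
  rw [crossRow, force_eq, force_eq, Nat.testBit_and, Nat.testBit_xor,
    testBit_block (mul_add_lt_mul hc hd), testBit_block (mul_add_lt_mul hc hd),
    testBit_ccwTable ha hc hd, testBit_ccwTable hb hc hd, testBit_blocks _ hc hd,
    testBit_block_ccwTable ha hb hc, testBit_block_ccwTable hb ha hc]
  · rw [← testBit_block_ccwTable hb ha hd, ← testBit_block_ccwTable ha hb hd]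
    cases ccw (natPt a) (natPt b) (natPt c) <;> cases ccw (natPt b) (natPt a) (natPt c) <;> simp
  · intro i _
    cases (block 34 ccwTable (34 * a + b)).testBit i <;>
      cases (block 34 ccwTable (34 * b + a)).testBit i <;>
      first
      | exact block_lt _ _ _
      | exact Nat.two_pow_pos _

theorem testBit_crossTable {a b c d : ℕ} (ha : a < 34) (hb : b < 34) (hc : c < 34) (hd : d < 34) :
    (crossTable ccwTable).testBit (34 * 34 * (34 * a + b) + (34 * c + d)) =
      (crossRow ccwTable a b).testBit (34 * c + d) := by
  rw [crossTable, testBit_blocks (fun v _ => crossRow_lt _ _ _) (mul_add_lt_mul ha hb)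
    (mul_add_lt_mul hc hd)]
  congr 2 <;> omega

theorem testBit_allSegments {c d : ℕ} (hc : c < 34) (hd : d < 34) :
    allSegments.testBit (34 * c + d) = decide (d < c) := by
  rw [allSegments, testBit_blocks (fun i _ => maskOf_lt _ _) hc hd, testBit_maskOf]
  rw [decide_eq_true hd, Bool.true_and, Bool.eq_iff_iff, Nat.blt_eq, decide_eq_true_iff]

/-! ### Crossing segments and orientations -/

/-- Twice the signed area of the triangle `pqr`. -/
def det (p q r : ℝ × ℝ) : ℝ :=
  p.1 * q.2 + q.1 * r.2 + r.1 * p.2 - (p.2 * q.1 + q.2 * r.1 + r.2 * p.1)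

theorem det_rotate (p q r : ℝ × ℝ) : det q r p = det p q r := by
  unfold det
  ring

theorem det_swap (p q r : ℝ × ℝ) : det q p r = -det p q r := by
  unfold det
  ring

theorem det_eq_zero_of_collinear {p q r : ℝ × ℝ} (h : Collinear ℝ ({p, q, r} : Set (ℝ × ℝ))) :
    det p q r = 0 := by
  obtain ⟨v, hv⟩ := (collinear_iff_of_mem (p₀ := p) (by simp)).1 h
  obtain ⟨s, rfl⟩ := hv q (by simp)
  obtain ⟨t, rfl⟩ := hv r (by simp)
  simp only [det, vadd_eq_add, Prod.fst_add, Prod.snd_add, Prod.smul_fst, Prod.smul_snd,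
    smul_eq_mul]
  ring

theorem Crosses.symm {p q r s : ℝ × ℝ} (h : Crosses p q r s) : Crosses r s p q := by
  obtain ⟨x, h1, h2, h3⟩ := h
  exact ⟨x, h2, h1, Set.inter_comm _ _ ▸ h3⟩

theorem Crosses.swap {p q r s : ℝ × ℝ} (h : Crosses p q r s) : Crosses q p r s := by
  rwa [Crosses, openSegment_symm, segment_symm]

theorem Crosses.det_mul_neg {p q r s : ℝ × ℝ} (h : Crosses p q r s)
    (h0 : ¬(det p q r = 0 ∧ det p q s = 0)) : det p q r * det p q s < 0 := by
  obtain ⟨x, ⟨a, b, ha, hb, hab, rfl⟩, ⟨c, d, hc, hd, hcd, h⟩, -⟩ := h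
  have h1 : c * r.1 + d * s.1 = a * p.1 + b * q.1 := congrArg Prod.fst h
  have h2 : c * r.2 + d * s.2 = a * p.2 + b * q.2 := congrArg Prod.snd h
  have key : c * det p q r = -d * det p q s := by
    obtain rfl : a = 1 - b := by linarith
    obtain rfl : c = 1 - d := by linarith
    unfold det
    linear_combination (p.2 - q.2) * h1 + (q.1 - p.1) * h2
  have hs : det p q s ≠ 0 := by
    intro hs
    rw [hs, mul_zero] at key
    exact h0 ⟨(mul_eq_zero.1 key).resolve_left hc.ne', hs⟩
  have : c * (det p q r * det p q s) = -(d * det p q s ^ 2) := by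
    linear_combination det p q s * key
  have : 0 < d * det p q s ^ 2 := by positivity
  by_contra hneg
  nlinarith [mul_nonneg hc.le (not_lt.1 hneg)]

theorem Crosses.ne {p q r s : ℝ × ℝ} (h : Crosses p q r s) (hpq : p ≠ q) :
    (r, s) ≠ (p, q) := by
  rintro ⟨⟩
  obtain ⟨x, -, -, h⟩ := h
  rw [Set.inter_self] at h
  have hp : p ∈ ({x} : Set (ℝ × ℝ)) := h ▸ left_mem_segment ℝ p q
  have hq : q ∈ ({x} : Set (ℝ × ℝ)) := h ▸ right_mem_segment ℝ p q
  exact hpq (hp.trans hq.symm)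

/-- The `i`-th point. -/
def pt (i : ℕ) : ℝ × ℝ := ((natPt i).1, (natPt i).2)

theorem ccw_natPt (a b c : ℕ) :
    ccw (natPt a) (natPt b) (natPt c) = decide (0 < det (pt a) (pt b) (pt c)) := by
  rw [Bool.eq_iff_iff, ccw, decide_eq_true_iff, Nat.blt_eq, det, sub_pos]
  dsimp only [pt]
  norm_cast

theorem det_pt_ne_zero {a b c : ℕ} (ha : a < 34) (hb : b < 34) (hc : c < 34) (hab : a ≠ b)
    (hac : a ≠ c) (hbc : b ≠ c) : det (pt a) (pt b) (pt c) ≠ 0 := by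
  have key : ∀ a < 34, ∀ b < a, ∀ c < b, det (pt a) (pt b) (pt c) ≠ 0 := by
    intro a ha b hb c hc h
    have := natPt_det_ne a ha b hb c hc
    simp [ccw_natPt, det_swap (pt a) (pt b), h] at this
  have h1 := det_rotate (pt a) (pt b) (pt c)
  have h2 := det_rotate (pt b) (pt c) (pt a)
  have h3 := det_swap (pt a) (pt b) (pt c)
  have h4 := det_rotate (pt b) (pt a) (pt c)
  have h5 := det_rotate (pt a) (pt c) (pt b)
  rcases Nat.lt_or_gt_of_ne hab with h | h <;> rcases Nat.lt_or_gt_of_ne hac with h' | h' <;>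
    rcases Nat.lt_or_gt_of_ne hbc with h'' | h'' <;> first
    | omega
    | have := key a ha b h c h''; grind
    | have := key a ha c h' b h''; grind
    | have := key b hb a h c h'; grind
    | have := key b hb c h'' a h'; grind
    | have := key c hc a h' b h; grind
    | have := key c hc b h'' a h; grind

theorem pt_injOn : Set.InjOn pt (Set.Iio 34) := by
  intro a ha b hb h
  by_contra hab
  obtain ⟨c, hc, hac, hbc⟩ : ∃ c < 34, a ≠ c ∧ b ≠ c := by
    by_cases h0 : a ≠ 0 ∧ b ≠ 0
    · exact ⟨0, by norm_num, h0.1, h0.2⟩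
    · by_cases h1 : a ≠ 1 ∧ b ≠ 1
      · exact ⟨1, by norm_num, h1.1, h1.2⟩
      · exact ⟨2, by norm_num, by omega, by omega⟩
  refine det_pt_ne_zero ha hb hc hab hac hbc ?_
  rw [h, det]
  ring

theorem det_mul_neg_of_crosses {a b c d : ℕ} (ha : a < 34) (hb : b < a) (hc : c < 34) (hd : d < c)
    (h : Crosses (pt a) (pt b) (pt c) (pt d)) :
    det (pt a) (pt b) (pt c) * det (pt a) (pt b) (pt d) < 0 := by
  refine h.det_mul_neg fun h0 => ?_
  have hc' : c = a ∨ c = b := by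
    by_contra! hne
    exact det_pt_ne_zero ha (hb.trans ha) hc hb.ne' hne.1.symm hne.2.symm h0.1
  have hd' : d = a ∨ d = b := by
    by_contra! hne
    exact det_pt_ne_zero ha (hb.trans ha) (hd.trans hc) hb.ne' hne.1.symm hne.2.symm h0.2
  obtain ⟨rfl, rfl⟩ : c = a ∧ d = b := by omega
  exact h.ne (fun h => hb.ne' (pt_injOn ha (hb.trans ha) h)) rfl

/-- The vertex of the crossing graph for the segment with endpoints `a` and `b`. -/
def vertex (a b : ℕ) : ℕ := 64 + (34 * a + b)

/-- The rows of the crossing graph. -/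
def crossGraph : ℕ → ℕ := rowOf (34 * 34) (crossTable ccwTable)

theorem testBit_crossGraph {a b c d : ℕ} (ha : a < 34) (hb : b < 34) (hc : c < 34) (hd : d < 34) :
    (crossGraph (vertex a b)).testBit (vertex c d) =
      (crossRow ccwTable a b).testBit (34 * c + d) := by
  rw [crossGraph, vertex, vertex, testBit_rowOf _ _ (mul_add_lt_mul hc hd),
    testBit_crossTable ha hb hc hd]

theorem testBit_crossGraph_self {a b : ℕ} (ha : a < 34) (hb : b < 34) :
    (crossGraph (vertex a b)).testBit (vertex a b) = false := by
  have h1 : det (pt a) (pt b) (pt a) = 0 := by unfold det; ring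
  have h2 : det (pt b) (pt a) (pt a) = 0 := by unfold det; ring
  simp [testBit_crossGraph ha hb ha hb, testBit_crossRow ha hb ha hb, ccw_natPt, h1, h2]

theorem testBit_crossGraph_of_crosses {a b c d : ℕ} (ha : a < 34) (hb : b < a) (hc : c < 34)
    (hd : d < c) (h : Crosses (pt a) (pt b) (pt c) (pt d)) :
    (crossGraph (vertex a b)).testBit (vertex c d) = true := by
  have h1 := det_mul_neg_of_crosses ha hb hc hd h
  have h2 := det_mul_neg_of_crosses hc hd ha hb h.symm
  rw [det_rotate (pt a), det_rotate (pt b)] at h2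
  rw [testBit_crossGraph ha (hb.trans ha) hc (hd.trans hc),
    testBit_crossRow ha (hb.trans ha) hc (hd.trans hc)]
  simp only [ccw_natPt, det_swap (pt a) (pt b)]
  rcases mul_neg_iff.1 h1 with ⟨h3, h4⟩ | ⟨h3, h4⟩ <;>
    rcases mul_neg_iff.1 h2 with ⟨h5, h6⟩ | ⟨h5, h6⟩ <;>
    simp [h3, h4, h5, h6, h3.le, h5.le, h6.le]

theorem card_le_of_isCrossingFamily {F : Finset ((ℝ × ℝ) × (ℝ × ℝ))}
    (hF : IsCrossingFamily ((Finset.range 34).image pt) F) : F.card ≤ 7 := by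
  have hcode : ∀ e ∈ F, ∃ i : ℕ × ℕ, i.1 < 34 ∧ i.2 < i.1 ∧
      (e = (pt i.1, pt i.2) ∨ e = (pt i.2, pt i.1)) := by
    rintro ⟨p, q⟩ he
    obtain ⟨hp, hq, hpq⟩ := hF.1 _ he
    obtain ⟨a, ha, rfl⟩ := Finset.mem_image.1 hp
    obtain ⟨b, hb, rfl⟩ := Finset.mem_image.1 hq
    rw [Finset.mem_range] at ha hb
    rcases Nat.lt_trichotomy b a with h | rfl | h
    · exact ⟨(a, b), ha, h, Or.inl rfl⟩
    · exact absurd rfl hpq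
    · exact ⟨(b, a), hb, h, Or.inr rfl⟩
  choose! i hi1 hi2 hi using hcode
  have hself : ∀ e ∈ F, (crossGraph (vertex (i e).1 (i e).2)).testBit (vertex (i e).1 (i e).2)
      = false := fun e he => testBit_crossGraph_self (hi1 e he) ((hi2 e he).trans (hi1 e he))
  have hadj : ∀ e ∈ F, ∀ f ∈ F, e ≠ f →
      (crossGraph (vertex (i e).1 (i e).2)).testBit (vertex (i f).1 (i f).2) = true := by
    intro e he f hf hef
    refine testBit_crossGraph_of_crosses (hi1 e he) (hi2 e he) (hi1 f hf) (hi2 f hf) ?_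
    have h := hF.2 e he f hf hef
    rcases hi e he with h1 | h1 <;> rcases hi f hf with h2 | h2 <;> rw [h1, h2] at h
    · exact h
    · exact h.symm.swap.symm
    · exact h.swap
    · exact h.swap.symm.swap.symm
  have hinj : Set.InjOn (fun e => vertex (i e).1 (i e).2) F := by
    intro e he f hf h
    by_contra hef
    have h1 := hadj e he f hf hef
    rw [← show vertex (i e).1 (i e).2 = vertex (i f).1 (i f).2 from h, hself e he] at h1
    exact Bool.false_ne_true h1
  have hsearch := search_crossTable
  rw [force_eq, force_eq, force_eq, force_eq] at hsearch
  rw [← Finset.card_image_of_injOn hinj]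
  refine card_le_of_search _ hsearch _ ?_ ?_ ?_
  · exact Finset.forall_mem_image.2 fun e _ => Nat.le_add_right _ _
  · refine Finset.forall_mem_image.2 fun e he => Finset.forall_mem_image.2 fun f hf => ?_
    by_cases hef : e = f
    · subst hef
      exact (hself e he).trans (by simp)
    · have hne : vertex (i e).1 (i e).2 ≠ vertex (i f).1 (i f).2 := fun h => hef (hinj he hf h)
      exact (hadj e he f hf hef).trans (decide_eq_true hne).symm
  · refine Finset.filter_true_of_mem (Finset.forall_mem_image.2 fun e he => ?_)
    rw [vertex, Nat.testBit_shiftLeft, Nat.add_sub_cancel_left,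
      testBit_allSegments (hi1 e he) ((hi2 e he).trans (hi1 e he))]
    simp [hi2 e he]

/-- There exists a set of 34 points in the plane in general position that
contains no 8-crossing family. -/
theorem exists_34_points_without_8_crossing_family :
    ∃ S : Finset (ℝ × ℝ), S.card = 34 ∧ GenPos S ∧ ¬ HasCrossingFamily S 8 := by
  refine ⟨(Finset.range 34).image pt, ?_, ?_, ?_⟩
  · rw [Finset.card_image_of_injOn fun a ha b hb h => pt_injOn (by simpa using ha)
      (by simpa using hb) h, Finset.card_range]
  · refine Finset.forall_mem_image.2 fun a ha => Finset.forall_mem_image.2 fun b hb =>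
      Finset.forall_mem_image.2 fun c hc hab hac hbc h => ?_
    exact det_pt_ne_zero (Finset.mem_range.1 ha) (Finset.mem_range.1 hb) (Finset.mem_range.1 hc)
      (ne_of_apply_ne pt hab) (ne_of_apply_ne pt hac) (ne_of_apply_ne pt hbc)
      (det_eq_zero_of_collinear h)
  · rintro ⟨F, hF, hcard⟩
    have := card_le_of_isCrossingFamily hF
    omega
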